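/- Impulsive Gronwall inequality with Ψ-kernel: let U be nonnegative and piecewise continuous on (0,b], V nonnegative piecewise continuous, g ≥ 0 continuous, β_k > 0, and suppose U(t) ≤ V(t) + g(t) ∫₀ᵗ Ψ'(s)(Ψ(t) − Ψ(s))^{α−1} U(s) ds + Σ_{0<t_k<t} β_k U(t_k⁻) for all t. If additionally V is nondecreasing and g constant, then for t ∈ (t_k, t_{k+1}], U(t) ≤ V(t) [∏_{i=1}^k (1 + β_i E_α(g Γ(α)(Ψ(t_i) − Ψ(0))^α))] E_α(g Γ(α)(Ψ(t) − Ψ(0))^α). -/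

import Mathlib

open Set intervalIntegral Finset

/-- The one-parameter Mittag–Leffler function `E_α(z) = Σ zⁿ/Γ(nα+1)`. -/
noncomputable def mittagLeffler (α z : ℝ) : ℝ :=
  ∑' n : ℕ, z ^ n / Real.Gamma (n * α + 1)

open MeasureTheory Filter Topology
open scoped ENNReal

/-- Fractional integration kernel. -/
noncomputable def fker (a x : ℝ) : ℝ≥0∞ :=
  if 0 < x then ENNReal.ofReal (x ^ (a - 1) / Real.Gamma a) else 0

lemma fker_meas (a : ℝ) : Measurable (fker a) := by
  unfold fker
  exact Measurable.ite measurableSet_Ioi (by fun_prop) (by fun_prop)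

lemma fker_conv {a c : ℝ} (ha : 0 < a) (hc : 0 < c) :
    fker a ⋆ₗ fker c = fker (a + c) := by
  ext x
  rw [lconvolution_def]
  by_cases hx : 0 < x
  · have himg : (fun z : ℝ => x * z) '' Set.univ = Set.univ := by
      rw [Set.image_univ]
      exact (mul_left_surjective₀ hx.ne').range_eq
    have h1 := lintegral_image_eq_lintegral_abs_deriv_mul (s := Set.univ)
      (f := fun z : ℝ => x * z) (f' := fun _ => x) MeasurableSet.univ
      (fun z _ => by simpa using ((hasDerivAt_id z).const_mul x))
      ((mul_right_injective₀ hx.ne').injOn)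
      (fun y => fker a y * fker c (-y + x))
    rw [himg, Measure.restrict_univ] at h1
    rw [h1]
    have hGa := Real.Gamma_pos_of_pos ha
    have hGc := Real.Gamma_pos_of_pos hc
    have hGac := Real.Gamma_pos_of_pos (add_pos ha hc)
    have h2 : ∀ z, ENNReal.ofReal |x| * (fker a (x * z) * fker c (-(x * z) + x)) =
        ENNReal.ofReal (x ^ (a + c - 1) / Real.Gamma (a + c)) * ProbabilityTheory.betaPDF a c z := by
      intro z
      rw [ProbabilityTheory.betaPDF_eq]
      by_cases hz : 0 < z ∧ z < 1
      · rw [if_pos hz]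
        have hz1 : 0 < 1 - z := by linarith [hz.2]
        have e : -(x * z) + x = x * (1 - z) := by ring
        unfold fker
        rw [e, if_pos (mul_pos hx hz.1), if_pos (mul_pos hx hz1)]
        rw [← ENNReal.ofReal_mul (by have := Real.rpow_nonneg (mul_pos hx hz.1).le (a-1); positivity),
          ← ENNReal.ofReal_mul (abs_nonneg _), ← ENNReal.ofReal_mul (by positivity)]
        congr 1
        rw [abs_of_pos hx, Real.mul_rpow hx.le hz.1.le, Real.mul_rpow hx.le hz1.le]
        have e3 : x ^ (a + c - 1) = x * x ^ (a - 1) * x ^ (c - 1) := by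
          rw [show a + c - 1 = 1 + (a - 1) + (c - 1) by ring, Real.rpow_add hx, Real.rpow_add hx,
            Real.rpow_one]
        rw [e3, ProbabilityTheory.beta]
        field_simp
      · rw [if_neg hz]
        simp only [ENNReal.ofReal_zero, mul_zero, mul_eq_zero]
        right
        unfold fker
        by_cases hz0 : 0 < z
        · right
          rw [if_neg]
          have : 1 ≤ z := by
            by_contra h; exact hz ⟨hz0, by linarith⟩
          nlinarith
        · left
          rw [if_neg]
          nlinarith
    rw [lintegral_congr h2,
      lintegral_const_mul' _ _ ENNReal.ofReal_ne_top,
      ProbabilityTheory.lintegral_betaPDF_eq_one ha hc, mul_one]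
    unfold fker
    rw [if_pos hx]
  · have : ∀ y, fker a y * fker c (-y + x) = 0 := by
      intro y
      unfold fker
      by_cases hy : 0 < y
      · rw [if_neg (show ¬ 0 < -y + x by linarith)]; simp
      · rw [if_neg hy]; simp
    rw [lintegral_congr this]
    simp [fker, hx]

lemma gamma_step {α x : ℝ} (h0 : 0 < α) (h1 : α < 1) (hx : 1 ≤ x) :
    (x + α - 1) ^ α * Real.Gamma x ≤ Real.Gamma (x + α) := by
  have hp : 0 < x + α - 1 := by linarith
  have h := Real.Gamma_mul_add_mul_le_rpow_Gamma_mul_rpow_Gamma (s := x + α - 1) (t := x + α)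
    (a := α) (b := 1 - α) hp (by linarith) h0 (by linarith) (by ring)
  have e : α * (x + α - 1) + (1 - α) * (x + α) = x := by ring
  have e2 : Real.Gamma (x + α) = (x + α - 1) * Real.Gamma (x + α - 1) := by
    rw [← Real.Gamma_add_one hp.ne']; congr 1; ring
  have hG := Real.Gamma_pos_of_pos hp
  have hG2 : 0 < Real.Gamma (x + α) := Real.Gamma_pos_of_pos (by linarith)
  rw [e] at h
  calc _ ≤ (x + α - 1) ^ α * (Real.Gamma (x + α - 1) ^ α * Real.Gamma (x + α) ^ (1 - α)) := by
        gcongr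
    _ = ((x + α - 1) * Real.Gamma (x + α - 1)) ^ α * Real.Gamma (x + α) ^ (1 - α) := by
        rw [Real.mul_rpow hp.le hG.le]; ring
    _ = Real.Gamma (x + α) := by
        rw [← e2, ← Real.rpow_add hG2]; simp

lemma ml_summable {α : ℝ} (h0 : 0 < α) (h1 : α < 1) (z : ℝ) :
    Summable (fun n : ℕ => z ^ n / Real.Gamma (n * α + 1)) := by
  rcases eq_or_ne z 0 with rfl | hz
  · apply summable_of_ne_finset_zero (s := {0})
    intro n hn
    have : n ≠ 0 := by simpa using hn
    simp [this]
  have hG : ∀ n : ℕ, 0 < Real.Gamma (n * α + 1) := fun n => Real.Gamma_pos_of_pos (by positivity)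
  refine summable_of_ratio_test_tendsto_lt_one (l := 0) one_pos
    (Eventually.of_forall fun n => div_ne_zero (pow_ne_zero _ hz) (hG n).ne') ?_
  have hlim : Tendsto (fun n : ℕ => |z| / (((n : ℝ) + 1) * α) ^ α) atTop (𝓝 0) := by
    apply Tendsto.const_div_atTop
    apply (tendsto_rpow_atTop h0).comp
    apply Tendsto.atTop_mul_const h0
    exact tendsto_atTop_add_const_right _ _ tendsto_natCast_atTop_atTop
  refine squeeze_zero (fun n => by positivity) (fun n => ?_) hlim
  have hs := gamma_step h0 h1 (x := n * α + 1) (by have : 0 ≤ (n:ℝ) * α := by positivity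
                                                   linarith)
  have e1 : (n : ℝ) * α + 1 + α - 1 = ((n : ℝ) + 1) * α := by ring
  have e2 : (n : ℝ) * α + 1 + α = ((n + 1 : ℕ) : ℝ) * α + 1 := by push_cast; ring
  rw [e1, e2] at hs
  have hq : 0 < (((n : ℝ) + 1) * α) ^ α := by positivity
  have hzn : 0 < |z| := abs_pos.2 hz
  rw [norm_div, norm_div, norm_pow, norm_pow, Real.norm_eq_abs, Real.norm_of_nonneg (hG n).le,
    Real.norm_of_nonneg (hG (n+1)).le, div_div_div_eq, div_le_div_iff₀ (by have := hG (n+1); positivity) hq]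
  calc _ = |z| * |z| ^ n * ((((n : ℝ) + 1) * α) ^ α * Real.Gamma (n * α + 1)) := by ring
    _ ≤ |z| * |z| ^ n * Real.Gamma (((n + 1 : ℕ) : ℝ) * α + 1) := by gcongr
    _ = _ := by ring

lemma ml_pos_sum {α : ℝ} (h0 : 0 < α) (h1 : α < 1) {z : ℝ} (hz : 0 ≤ z) (n : ℕ) :
    ∑ j ∈ Finset.range n, z ^ j / Real.Gamma (j * α + 1) ≤ mittagLeffler α z := by
  unfold mittagLeffler
  exact (ml_summable h0 h1 z).sum_le_tsum _ fun j _ =>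
    div_nonneg (pow_nonneg hz _) (Real.Gamma_pos_of_pos (by positivity)).le

lemma ml_nonneg {α : ℝ} (h0 : 0 < α) (h1 : α < 1) {z : ℝ} (hz : 0 ≤ z) :
    0 ≤ mittagLeffler α z := by simpa using ml_pos_sum h0 h1 hz 0

lemma conv_mono {f g h : ℝ → ℝ≥0∞} (hgh : g ≤ h) : f ⋆ₗ g ≤ f ⋆ₗ h := by
  intro x
  rw [lconvolution_def, lconvolution_def]
  exact lintegral_mono fun y => mul_le_mul_right (hgh _) _

/-- Iterated estimate. -/
lemma iterate_bound {α : ℝ} (h0 : 0 < α) (A l : ℝ≥0∞) (hl : l ≠ ∞) (hA : A ≠ ∞) (w : ℝ → ℝ≥0∞)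
    (hw : AEMeasurable w) 
    (h : ∀ x, w x ≤ A * fker 1 x + l * (fker α ⋆ₗ w) x) (n : ℕ) (x : ℝ) :
    w x ≤ A * ∑ j ∈ Finset.range (n + 1), l ^ j * fker (j * α + 1) x
      + l ^ (n + 1) * (fker ((n + 1 : ℕ) * α) ⋆ₗ w) x := by
  induction n with
  | zero => simpa using h x
  | succ n ih =>
    refine ih.trans ?_
    rw [Finset.sum_range_succ _ (n + 1), mul_add, add_assoc]
    gcongr
    have hpos : 0 < ((n + 1 : ℕ) : ℝ) * α := by positivity
    have hm : fker ((n + 1 : ℕ) * α) ⋆ₗ w ≤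
        fker ((n + 1 : ℕ) * α) ⋆ₗ (fun x => A * fker 1 x + l * (fker α ⋆ₗ w) x) :=
      conv_mono h
    have he : (fker ((n + 1 : ℕ) * α) ⋆ₗ (fun x => A * fker 1 x + l * (fker α ⋆ₗ w) x)) x
        = A * fker ((n + 1 : ℕ) * α + 1) x + l * (fker ((n + 1 + 1 : ℕ) * α) ⋆ₗ w) x := by
      have e1 : ((n + 1 + 1 : ℕ) : ℝ) * α = (n + 1 : ℕ) * α + α := by push_cast; ring
      rw [e1, ← fker_conv hpos one_pos, ← fker_conv hpos h0,
        ← lconvolution_assoc₀ (fker_meas _).aemeasurable (fker_meas _).aemeasurable hw]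
      simp only [lconvolution_def (f := fker ((n + 1 : ℕ) * α))]
      rw [← lintegral_const_mul' _ _ hA, ← lintegral_const_mul' _ _ hl, ← lintegral_add_left]
      · congr 1; ext y; ring
      · have := fker_meas ((n + 1 : ℕ) * α)
        have := fker_meas 1
        fun_prop
    calc l ^ (n + 1) * (fker ((n + 1 : ℕ) * α) ⋆ₗ w) x
        ≤ l ^ (n + 1) * (A * fker ((n + 1 : ℕ) * α + 1) x + l * (fker ((n + 1 + 1 : ℕ) * α) ⋆ₗ w) x) := by
          rw [← he]; gcongr; exact hm x
      _ = _ := by ring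

/-- Fractional Gronwall inequality on the half line, in the extended nonnegative reals. -/
lemma frac_gronwall {α : ℝ} (h0 : 0 < α) (h1 : α < 1) {A l : ℝ} (hA : 0 ≤ A) (hl : 0 ≤ l)
    (w : ℝ → ℝ≥0∞) (hw : AEMeasurable w) (hfin : ∫⁻ x, w x ≠ ∞)
    (hw0 : ∀ x ≤ 0, w x = 0)
    (h : ∀ x, w x ≤ ENNReal.ofReal A * fker 1 x + ENNReal.ofReal l * (fker α ⋆ₗ w) x)
    {x : ℝ} (hx : 0 < x) :
    w x ≤ ENNReal.ofReal (A * mittagLeffler α (l * x ^ α)) := by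
  set z := l * x ^ α with hz
  have hz0 : 0 ≤ z := by positivity
  set C := (∫⁻ x, w x).toReal with hC
  have hxa : ∀ n : ℕ, x ^ ((n : ℝ) * α) = (x ^ α) ^ n := fun n => by
    rw [mul_comm, Real.rpow_mul hx.le, Real.rpow_natCast]
  have key : ∀ᶠ n : ℕ in atTop, w x ≤ ENNReal.ofReal (A * mittagLeffler α z +
      α / x * C * ((2 * z) ^ (n + 1) / Real.Gamma ((n + 1 : ℕ) * α + 1))) := by
    have ev : ∀ᶠ n : ℕ in atTop, 1 ≤ ((n + 1 : ℕ) : ℝ) * α := by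
      have : Tendsto (fun n : ℕ => ((n + 1 : ℕ) : ℝ) * α) atTop atTop := by
        apply Tendsto.atTop_mul_const h0
        exact tendsto_natCast_atTop_atTop.comp (tendsto_add_atTop_nat 1)
      exact this.eventually_ge_atTop 1
    filter_upwards [ev] with n hn
    have hE := ml_nonneg h0 h1 hz0
    have hCn : 0 ≤ C := ENNReal.toReal_nonneg
    have hGp : 0 < Real.Gamma ((n + 1 : ℕ) * α + 1) := Real.Gamma_pos_of_pos (by positivity)
    have hGp2 : 0 < Real.Gamma ((n + 1 : ℕ) * α) := Real.Gamma_pos_of_pos (by positivity)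
    refine (iterate_bound h0 _ _ ENNReal.ofReal_ne_top ENNReal.ofReal_ne_top w hw h n x).trans ?_
    rw [ENNReal.ofReal_add (by positivity) (by positivity)]
    apply add_le_add
    · rw [ENNReal.ofReal_mul hA]
      gcongr
      refine le_trans (le_of_eq ?_) (ENNReal.ofReal_le_ofReal (ml_pos_sum h0 h1 hz0 (n + 1)))
      rw [ENNReal.ofReal_sum_of_nonneg]
      · apply Finset.sum_congr rfl
        intro j _
        unfold fker
        rw [if_pos hx, ← ENNReal.ofReal_pow hl, ← ENNReal.ofReal_mul (by positivity)]
        congr 1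
        rw [add_sub_cancel_right, hxa, hz, mul_pow]
        ring
      · intro j _
        have : 0 < Real.Gamma (j * α + 1) := Real.Gamma_pos_of_pos (by positivity)
        positivity
    · have hb : (fker ((n + 1 : ℕ) * α) ⋆ₗ w) x ≤
          ENNReal.ofReal (x ^ (((n + 1 : ℕ) : ℝ) * α - 1) / Real.Gamma ((n + 1 : ℕ) * α)) *
            ENNReal.ofReal C := by
        rw [hC, ENNReal.ofReal_toReal hfin, lconvolution_comm, lconvolution_def,
          ← lintegral_const_mul' _ _ ENNReal.ofReal_ne_top]
        apply lintegral_mono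
        intro y
        beta_reduce
        rw [mul_comm (w y)]
        rcases le_or_gt y 0 with hy | hy
        · simp [hw0 y hy]
        · gcongr
          unfold fker
          split_ifs with h3
          · gcongr
            linarith
          · exact zero_le
      calc _ ≤ ENNReal.ofReal l ^ (n + 1) * (ENNReal.ofReal (x ^ (((n + 1 : ℕ) : ℝ) * α - 1) / Real.Gamma ((n + 1 : ℕ) * α)) *
            ENNReal.ofReal C) := by gcongr
        _ = ENNReal.ofReal (l ^ (n + 1) * (x ^ (((n + 1 : ℕ) : ℝ) * α - 1) / Real.Gamma ((n + 1 : ℕ) * α) * C)) := by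
          rw [← ENNReal.ofReal_pow hl, ← ENNReal.ofReal_mul (by positivity),
            ← ENNReal.ofReal_mul (by positivity)]
        _ ≤ _ := by
          apply ENNReal.ofReal_le_ofReal
          rw [Real.Gamma_add_one (by positivity), Real.rpow_sub_one hx.ne', hxa, mul_pow, hz,
            mul_pow]
          have h2 : ((n + 1 : ℕ) : ℝ) ≤ 2 ^ (n + 1) := by
            exact_mod_cast (Nat.lt_two_pow_self (n := n + 1)).le
          have hP : 0 ≤ l ^ (n + 1) * (x ^ α) ^ (n + 1) * C / (x * Real.Gamma ((n + 1 : ℕ) * α)) := by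
            positivity
          have hnp : (0 : ℝ) < ((n + 1 : ℕ) : ℝ) := by positivity
          calc _ = l ^ (n + 1) * (x ^ α) ^ (n + 1) * C / (x * Real.Gamma ((n + 1 : ℕ) * α)) * 1 := by
                field_simp
            _ ≤ l ^ (n + 1) * (x ^ α) ^ (n + 1) * C / (x * Real.Gamma ((n + 1 : ℕ) * α)) *
                  (2 ^ (n + 1) / ((n + 1 : ℕ) : ℝ)) := by
                gcongr
                rw [le_div_iff₀ hnp]; linarith
            _ = _ := by field_simp
  have hlim : Tendsto (fun n : ℕ => ENNReal.ofReal (A * mittagLeffler α z +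
      α / x * C * ((2 * z) ^ (n + 1) / Real.Gamma ((n + 1 : ℕ) * α + 1)))) atTop
      (𝓝 (ENNReal.ofReal (A * mittagLeffler α z))) := by
    apply ENNReal.tendsto_ofReal
    have := ((ml_summable h0 h1 (2 * z)).tendsto_atTop_zero.comp (tendsto_add_atTop_nat 1)).const_mul
      (α / x * C)
    simpa using this.const_add (A * mittagLeffler α z)
  exact ge_of_tendsto hlim key

/-- Gronwall inequality with a Psi-kernel, without impulses. -/
lemma psi_gronwall {α T g A : ℝ} (h0 : 0 < α) (h1 : α < 1) (hT : 0 < T) (hg : 0 ≤ g) (hA : 0 ≤ A)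
    (Ψ Ψ' U : ℝ → ℝ) (hderiv : ∀ x ∈ Set.Icc (0:ℝ) T, HasDerivAt Ψ (Ψ' x) x)
    (hmono : StrictMonoOn Ψ (Set.Icc (0:ℝ) T))
    (hUnn : ∀ t ∈ Set.Ioc (0:ℝ) T, 0 ≤ U t)
    (hm : Measurable ((Set.Ioc (0:ℝ) T).indicator U))
    (hfin : ∫⁻ s in Set.Ioc (0:ℝ) T, ENNReal.ofReal |Ψ' s| * ENNReal.ofReal (U s) ≠ ∞)
    (h : ∀ t ∈ Set.Ioc (0:ℝ) T,
      U t ≤ A + g * (∫ s in (0:ℝ)..t, Ψ' s * (Ψ t - Ψ s) ^ (α - 1) * U s)) :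
    U T ≤ A * mittagLeffler α (g * Real.Gamma α * (Ψ T - Ψ 0) ^ α) := by
  classical
  have hG := Real.Gamma_pos_of_pos h0
  set I := Set.Ioc (0:ℝ) T with hI
  have hIm : MeasurableSet I := measurableSet_Ioc
  have hsub : I ⊆ Set.Icc 0 T := Set.Ioc_subset_Icc_self
  set Φ : ℝ → ℝ := fun s => Ψ s - Ψ 0 with hΦ
  have hΦm : StrictMonoOn Φ I := fun a ha c hc hac => by
    have := hmono (hsub ha) (hsub hc) hac
    simp only [hΦ]; linarith
  have hΦd : ∀ x ∈ I, HasDerivWithinAt Φ (Ψ' x) I x := fun x hx =>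
    ((hderiv x (hsub hx)).sub_const _).hasDerivWithinAt
  have hΦc : ContinuousOn Φ I := fun x hx => (hΦd x hx).continuousWithinAt
  have hΦpos : ∀ s ∈ I, 0 < Φ s := fun s hs => by
    have := hmono (Set.left_mem_Icc.2 hT.le) (hsub hs) hs.1
    simp only [hΦ]; linarith
  set S := Φ '' I with hS
  have hSm : MeasurableSet S := hIm.image_of_continuousOn_injOn hΦc hΦm.injOn
  set φ := Function.invFunOn Φ I with hφ
  have hφl : ∀ s ∈ I, φ (Φ s) = s := fun s hs => hΦm.injOn.leftInvOn_invFunOn hs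
  have hφm : MonotoneOn φ S := by
    rintro _ ⟨a, ha, rfl⟩ _ ⟨c, hc, rfl⟩ hac
    rw [hφl a ha, hφl c hc]
    exact (hΦm.le_iff_le ha hc).1 hac
  set w : ℝ → ℝ≥0∞ := S.indicator (fun x => ENNReal.ofReal (I.indicator U (φ x))) with hw
  have hwΦ : ∀ s ∈ I, w (Φ s) = ENNReal.ofReal (U s) := fun s hs => by
    rw [hw, Set.indicator_of_mem (Set.mem_image_of_mem _ hs), hφl s hs, Set.indicator_of_mem hs]
  have hw0 : ∀ x, x ∉ S → w x = 0 := fun x hx => Set.indicator_of_notMem hx _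
  have hwm : AEMeasurable w := by
    rw [hw, aemeasurable_indicator_iff hSm]
    exact ENNReal.measurable_ofReal.comp_aemeasurable
      (hm.comp_aemeasurable (aemeasurable_restrict_of_monotoneOn hSm hφm))
  have hcv : ∀ F : ℝ → ℝ≥0∞, ∫⁻ y, w y * F y =
      ∫⁻ s in I, ENNReal.ofReal |Ψ' s| * (ENNReal.ofReal (U s) * F (Φ s)) := by
    intro F
    have e1 : ∫⁻ y, w y * F y = ∫⁻ y in S, w y * F y := by
      rw [← lintegral_indicator hSm]
      congr 1; ext y
      by_cases hy : y ∈ S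
      · rw [Set.indicator_of_mem hy]
      · rw [Set.indicator_of_notMem hy, hw0 y hy, zero_mul]
    rw [e1, hS, lintegral_image_eq_lintegral_abs_deriv_mul hIm hΦd hΦm.injOn]
    refine setLIntegral_congr_fun hIm fun s hs => ?_
    rw [hwΦ s hs]
  have hTI : T ∈ I := ⟨hT, le_rfl⟩
  have hwfin : ∫⁻ x, w x ≠ ∞ := by
    have := hcv (fun _ => 1)
    simp only [mul_one] at this
    rw [this]; exact hfin
  have hwneg : ∀ x ≤ 0, w x = 0 := fun x hx => hw0 x (by
    rintro ⟨s, hs, rfl⟩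
    exact absurd (hΦpos s hs) (not_lt.2 hx))
  have hwineq : ∀ x, w x ≤ ENNReal.ofReal A * fker 1 x +
      ENNReal.ofReal (g * Real.Gamma α) * (fker α ⋆ₗ w) x := by
    intro x
    by_cases hx : x ∈ S
    · obtain ⟨t, ht, rfl⟩ := hx
      rw [hwΦ t ht]
      have hk1 : fker 1 (Φ t) = 1 := by
        unfold fker
        rw [if_pos (hΦpos t ht)]; simp
      rw [hk1, mul_one, lconvolution_comm, lconvolution_def, hcv]
      refine (ENNReal.ofReal_le_ofReal (h t ht)).trans (ENNReal.ofReal_add_le.trans ?_)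
      gcongr
      rw [ENNReal.ofReal_mul hg, ENNReal.ofReal_mul hg, mul_assoc]
      gcongr
      rw [← lintegral_const_mul' _ _ ENNReal.ofReal_ne_top, intervalIntegral.integral_of_le ht.1.le]
      refine (Real.ofReal_le_enorm _).trans ((enorm_integral_le_lintegral_enorm _).trans ?_)
      have hsubt : Set.Ioc 0 t ⊆ I := Set.Ioc_subset_Ioc_right ht.2
      refine le_trans ?_ (lintegral_mono_set hsubt)
      refine setLIntegral_mono' measurableSet_Ioc fun s hs => ?_
      rcases eq_or_lt_of_le hs.2 with rfl | hst
      · have : α - 1 ≠ 0 := by linarith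
        simp [Real.zero_rpow this]
      · have hlt := hΦm (hsubt hs) ht hst
        have hlt' : 0 < Ψ t - Ψ s := by simp only [hΦ] at hlt; linarith
        unfold fker
        rw [if_pos (by linarith), enorm_mul, enorm_mul, Real.enorm_eq_ofReal_abs,
          Real.enorm_of_nonneg (Real.rpow_nonneg hlt'.le _), Real.enorm_of_nonneg (hUnn s (hsubt hs))]
        have e : Ψ t - Ψ s = -Φ s + Φ t := by simp only [hΦ]; ring
        rw [← e]
        have e2 : ENNReal.ofReal ((Ψ t - Ψ s) ^ (α - 1)) = ENNReal.ofReal (Real.Gamma α) *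
            ENNReal.ofReal ((Ψ t - Ψ s) ^ (α - 1) / Real.Gamma α) := by
          rw [← ENNReal.ofReal_mul hG.le]; congr 1; field_simp
        rw [e2]
        apply le_of_eq; ring
    · rw [hw0 x hx]; exact zero_le
  have hfinal := frac_gronwall h0 h1 hA (mul_nonneg hg hG.le) w hwm hwfin hwneg hwineq (hΦpos T hTI)
  rw [hwΦ T hTI] at hfinal
  have hzn : 0 ≤ g * Real.Gamma α * (Φ T) ^ α := by
    have := Real.rpow_nonneg (hΦpos T hTI).le α
    positivity
  exact (ENNReal.ofReal_le_ofReal_iff (mul_nonneg hA (ml_nonneg h0 h1 hzn))).1 hfinal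

lemma prod_telescope (x : ℕ → ℝ) (k : ℕ) :
    ∏ i ∈ Finset.Icc 1 k, (1 + x i) =
      1 + ∑ i ∈ Finset.Icc 1 k, x i * ∏ j ∈ Finset.Icc 1 (i - 1), (1 + x j) := by
  induction k with
  | zero => simp
  | succ k ih =>
    rw [Finset.prod_Icc_succ_top (by omega), Finset.sum_Icc_succ_top (by omega),
      Nat.add_sub_cancel, mul_add, mul_one]
    nth_rewrite 1 [ih]
    ring

/-- impulsive Gronwall inequality with Ψ-kernel. -/
theorem impulsive_gronwall_psi
    (b α : ℝ) (hb : 0 < b) (hα0 : 0 < α) (hα1 : α < 1)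
    (p : ℕ) (tk : ℕ → ℝ) (htk0 : tk 0 = 0) (htkb : tk (p + 1) = b)
    (htkmono : ∀ k ≤ p, tk k < tk (k + 1))
    (β : ℕ → ℝ) (hβ : ∀ k ∈ Finset.Icc 1 p, 0 < β k)
    (Ψ Ψ' : ℝ → ℝ)
    (hderiv : ∀ x ∈ Set.Icc (0:ℝ) b, HasDerivAt Ψ (Ψ' x) x)
    (hΨ'cont : ContinuousOn Ψ' (Set.Icc (0:ℝ) b))
    (hmonoΨ : StrictMonoOn Ψ (Set.Icc (0:ℝ) b))
    (hΨ'ne : ∀ x ∈ Set.Icc (0:ℝ) b, Ψ' x ≠ 0)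
    (U V : ℝ → ℝ) (g : ℝ) (hg : 0 ≤ g)
    (hUnn : ∀ t ∈ Set.Ioc (0:ℝ) b, 0 ≤ U t)
    (hVnn : ∀ t ∈ Set.Ioc (0:ℝ) b, 0 ≤ V t)
    (hUpc : ∀ k ≤ p, ContinuousOn U (Set.Ioc (tk k) (tk (k + 1))))
    (hVpc : ∀ k ≤ p, ContinuousOn V (Set.Ioc (tk k) (tk (k + 1))))
    (hVmono : MonotoneOn V (Set.Ioc (0:ℝ) b))
    (hineq : ∀ t ∈ Set.Ioc (0:ℝ) b,
      U t ≤ V t + g * (∫ s in (0:ℝ)..t, Ψ' s * (Ψ t - Ψ s) ^ (α - 1) * U s)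
        + ∑ k ∈ Finset.Icc 1 p, if tk k < t then β k * U (tk k) else 0) :
    ∀ k ≤ p, ∀ t ∈ Set.Ioc (tk k) (tk (k + 1)),
      U t ≤ V t *
        (∏ i ∈ Finset.Icc 1 k,
          (1 + β i * mittagLeffler α (g * Real.Gamma α * (Ψ (tk i) - Ψ 0) ^ α))) *
        mittagLeffler α (g * Real.Gamma α * (Ψ t - Ψ 0) ^ α) := by
  classical
  have hlt : ∀ j, j ≤ p + 1 → ∀ i, i < j → tk i < tk j := by
    intro j
    induction j with
    | zero => intro _ i hi; omega
    | succ j ih =>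
      intro hj i hi
      rcases Nat.lt_succ_iff_lt_or_eq.1 hi with h | h
      · exact (ih (by omega) i h).trans (htkmono j (by omega))
      · rw [h]; exact htkmono j (by omega)
  have hle : ∀ j, j ≤ p + 1 → ∀ i, i ≤ j → tk i ≤ tk j := fun j hj i hi => by
    rcases hi.lt_or_eq with h | h
    · exact (hlt j hj i h).le
    · rw [h]
  have htk_nn : ∀ j, j ≤ p + 1 → 0 ≤ tk j := fun j hj => htk0 ▸ hle j hj 0 (by omega)
  have htk_le : ∀ j, j ≤ p + 1 → tk j ≤ b := fun j hj => htkb ▸ hle (p+1) le_rfl j hj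
  have htk_mem : ∀ i ∈ Finset.Icc 1 p, tk i ∈ Set.Ioc 0 b := fun i hi => by
    rw [Finset.mem_Icc] at hi
    exact ⟨htk0 ▸ hlt i (by omega) 0 (by omega), htk_le i (by omega)⟩
  have hterm : ∀ i ∈ Finset.Icc 1 p, 0 ≤ β i * U (tk i) := fun i hi =>
    mul_nonneg (hβ i hi).le (hUnn _ (htk_mem i hi))
  have hΨlt : ∀ t ∈ Set.Ioc 0 b, 0 < Ψ t - Ψ 0 := fun t ht => sub_pos.2
    (hmonoΨ (Set.left_mem_Icc.2 hb.le) (Set.Ioc_subset_Icc_self ht) ht.1)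
  have hsub : ∀ k ≤ p, Set.Ioc (tk k) (tk (k + 1)) ⊆ Set.Ioc 0 b := fun k hk t ht =>
    ⟨(htk_nn k (by omega)).trans_lt ht.1, ht.2.trans (htk_le _ (by omega))⟩
  have hmeas : ∀ k ≤ p + 1, Measurable ((Set.Ioc 0 (tk k)).indicator U) := by
    intro k
    induction k with
    | zero => intro _; simp [htk0]
    | succ k ih =>
      intro hk
      have hu : Set.Ioc 0 (tk (k + 1)) = Set.Ioc 0 (tk k) ∪ Set.Ioc (tk k) (tk (k + 1)) :=
        (Set.Ioc_union_Ioc_eq_Ioc (htk_nn k (by omega)) (htkmono k (by omega)).le).symm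
      rw [hu, Set.indicator_union_of_disjoint]
      · refine (ih (by omega)).add ?_
        have h0 := (hUpc k (by omega)).measurable_piecewise
          (g := fun _ => (0 : ℝ)) continuousOn_const measurableSet_Ioc
        rw [← Set.piecewise_eq_indicator]
        exact h0
      · rw [Set.disjoint_left]
        intro x hx hx'
        exact absurd hx.2 (not_le.2 hx'.1)
  set w : ℝ → ℝ≥0∞ := fun s => ENNReal.ofReal |Ψ' s| * ENNReal.ofReal (U s) with hw
  have hbdd : ∀ c d M : ℝ, 0 ≤ c → d ≤ b → (∀ s ∈ Set.Ioc c d, U s ≤ M) →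
      ∫⁻ s in Set.Ioc c d, w s ≠ ∞ := by
    intro c d M hc hd hM
    obtain ⟨K, hK⟩ := isCompact_Icc.exists_bound_of_continuousOn hΨ'cont
    have : ∫⁻ s in Set.Ioc c d, w s ≤
        ∫⁻ s in Set.Ioc c d, ENNReal.ofReal K * ENNReal.ofReal M := by
      refine setLIntegral_mono' measurableSet_Ioc fun s hs => ?_
      exact mul_le_mul' (ENNReal.ofReal_le_ofReal (hK s ⟨hc.trans hs.1.le, hs.2.trans hd⟩))
        (ENNReal.ofReal_le_ofReal (hM s hs))
    refine ne_top_of_le_ne_top ?_ this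
    rw [setLIntegral_const, Real.volume_Ioc]
    exact ENNReal.mul_ne_top (ENNReal.mul_ne_top ENNReal.ofReal_ne_top ENNReal.ofReal_ne_top)
      ENNReal.ofReal_ne_top
  have hunion : ∀ c d e : ℝ, c ≤ d → d ≤ e → ∫⁻ s in Set.Ioc c d, w s ≠ ∞ →
      ∫⁻ s in Set.Ioc d e, w s ≠ ∞ → ∫⁻ s in Set.Ioc c e, w s ≠ ∞ := by
    intro c d e hcd hde h1 h2
    rw [← Set.Ioc_union_Ioc_eq_Ioc hcd hde]
    exact ne_top_of_le_ne_top (ENNReal.add_ne_top.2 ⟨h1, h2⟩) (lintegral_union_le _ _ _)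
  have hjunk : ∀ t ∈ Set.Ioc 0 b, ∫⁻ s in Set.Ioc 0 t, w s = ∞ →
      ∫ s in (0:ℝ)..t, Ψ' s * (Ψ t - Ψ s) ^ (α - 1) * U s = 0 := by
    intro t ht hinf
    rw [intervalIntegral.integral_of_le ht.1.le]
    apply MeasureTheory.integral_undef
    intro hint
    have hfi := hint.2
    rw [hasFiniteIntegral_iff_enorm] at hfi
    have hc : 0 < (Ψ t - Ψ 0) ^ (α - 1) := Real.rpow_pos_of_pos (hΨlt t ht) _
    have hle2 : ENNReal.ofReal ((Ψ t - Ψ 0) ^ (α - 1)) * ∫⁻ s in Set.Ioc 0 t, w s ≤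
        ∫⁻ s in Set.Ioc 0 t, ‖Ψ' s * (Ψ t - Ψ s) ^ (α - 1) * U s‖ₑ := by
      rw [← lintegral_const_mul' _ _ ENNReal.ofReal_ne_top, ← restrict_Ioo_eq_restrict_Ioc]
      refine setLIntegral_mono' measurableSet_Ioo fun s hs => ?_
      have hs0 : s ∈ Set.Ioc 0 b := ⟨hs.1, hs.2.le.trans ht.2⟩
      have h3 : 0 < Ψ t - Ψ s := sub_pos.2
        (hmonoΨ (Set.Ioc_subset_Icc_self hs0) (Set.Ioc_subset_Icc_self ht) hs.2)
      have h4 := hΨlt s hs0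
      rw [enorm_mul, enorm_mul, Real.enorm_eq_ofReal_abs,
          Real.enorm_of_nonneg (Real.rpow_nonneg h3.le _), Real.enorm_of_nonneg (hUnn s hs0)]
      rw [mul_comm (ENNReal.ofReal |Ψ' s|), mul_assoc]
      refine mul_le_mul' (ENNReal.ofReal_le_ofReal ?_) le_rfl
      exact Real.rpow_le_rpow_of_nonpos h3 (by linarith) (by linarith)
    rw [hinf, ENNReal.mul_top (by simpa using hc)] at hle2
    exact absurd hfi (not_lt.2 hle2)
  have hfin : ∀ k ≤ p + 1, ∫⁻ s in Set.Ioc 0 (tk k), w s ≠ ∞ := by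
    intro k
    induction k with
    | zero => intro _; simp [htk0]
    | succ k ih =>
      intro hk
      have ih' := ih (by omega)
      by_cases hex : ∃ t ∈ Set.Ioc (tk k) (tk (k + 1)), ∫⁻ s in Set.Ioc 0 t, w s ≠ ∞
      · obtain ⟨t, ht, htf⟩ := hex
        have ht0 := (hsub k (by omega) ht).1
        refine hunion 0 t _ ht0.le ht.2 htf ?_
        obtain ⟨M, hM⟩ := (isCompact_Icc (a := t) (b := tk (k + 1))).exists_bound_of_continuousOn
          ((hUpc k (by omega)).mono fun s hs => ⟨ht.1.trans_le hs.1, hs.2⟩)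
        exact hbdd t _ M ht0.le (htk_le _ hk) fun s hs =>
          (le_abs_self _).trans (hM s (Set.Ioc_subset_Icc_self hs))
      · push Not at hex
        refine hunion 0 (tk k) _ (htk_nn k (by omega)) (htkmono k (by omega)).le ih' ?_
        refine hbdd _ _ (V b + ∑ i ∈ Finset.Icc 1 p, β i * U (tk i)) (htk_nn k (by omega))
          (htk_le _ hk) fun s hs => ?_
        have hs0 := hsub k (by omega) hs
        have h5 := hineq s hs0
        rw [hjunk s hs0 (hex s hs), mul_zero, add_zero] at h5
        refine h5.trans (add_le_add (hVmono hs0 ⟨hb, le_rfl⟩ hs0.2) (Finset.sum_le_sum fun i hi => ?_))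
        split_ifs
        · exact le_rfl
        · exact hterm i hi
  have hmain : ∀ k ≤ p, ∀ t ∈ Set.Ioc (tk k) (tk (k + 1)),
      U t ≤ (V t + ∑ i ∈ Finset.Icc 1 k, β i * U (tk i)) *
        mittagLeffler α (g * Real.Gamma α * (Ψ t - Ψ 0) ^ α) := by
    intro k hk t ht
    have ht0 := hsub k hk ht
    have hsubt : Set.Ioc 0 t ⊆ Set.Ioc 0 b := Set.Ioc_subset_Ioc_right ht0.2
    have hsubt' : Set.Icc 0 t ⊆ Set.Icc 0 b := Set.Icc_subset_Icc_right ht0.2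
    have hsubk : Finset.Icc 1 k ⊆ Finset.Icc 1 p := Finset.Icc_subset_Icc_right hk
    refine psi_gronwall hα0 hα1 ht0.1 hg ?_ Ψ Ψ' U (fun x hx => hderiv x (hsubt' hx))
      (hmonoΨ.mono hsubt') (fun s hs => hUnn s (hsubt hs)) ?_ ?_ ?_
    · exact add_nonneg (hVnn t ht0) (Finset.sum_nonneg fun i hi => hterm i (hsubk hi))
    · have h6 := (hmeas (p + 1) le_rfl).indicator (measurableSet_Ioc (a := (0:ℝ)) (b := t))
      rwa [htkb, Set.indicator_indicator, Set.inter_eq_left.2 hsubt] at h6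
    · have h7 := hfin (p + 1) le_rfl
      rw [htkb] at h7
      exact ne_top_of_le_ne_top h7 (lintegral_mono_set hsubt)
    · intro s hs
      have h8 := hineq s (hsubt hs)
      have h9 := hVmono (hsubt hs) ht0 hs.2
      have h10 : (∑ i ∈ Finset.Icc 1 p, if tk i < s then β i * U (tk i) else 0) ≤
          ∑ i ∈ Finset.Icc 1 k, β i * U (tk i) := by
        rw [← Finset.sum_filter]
        refine Finset.sum_le_sum_of_subset_of_nonneg ?_ fun i hi _ => hterm i (hsubk hi)
        intro i hi
        rw [Finset.mem_filter, Finset.mem_Icc] at hi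
        rw [Finset.mem_Icc]
        refine ⟨hi.1.1, ?_⟩
        by_contra hcon
        have := hle i (by omega) (k + 1) (by omega)
        linarith [hi.2, hs.2, ht.2]
      linarith
  have hE : ∀ t ∈ Set.Ioc 0 b, 0 ≤ mittagLeffler α (g * Real.Gamma α * (Ψ t - Ψ 0) ^ α) := by
    intro t ht
    have := Real.rpow_nonneg (hΨlt t ht).le α
    have := Real.Gamma_pos_of_pos hα0
    exact ml_nonneg hα0 hα1 (by positivity)
  intro k
  induction k using Nat.strong_induction_on with
  | _ k ih =>
    intro hk t ht
    have ht0 := hsub k hk ht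
    refine (hmain k hk t ht).trans (mul_le_mul_of_nonneg_right ?_ (hE t ht0))
    rw [prod_telescope, mul_add, mul_one, Finset.mul_sum]
    refine add_le_add le_rfl (Finset.sum_le_sum fun i hi => ?_)
    have hip : i ∈ Finset.Icc 1 p := Finset.Icc_subset_Icc_right hk hi
    rw [Finset.mem_Icc] at hi
    obtain ⟨m, rfl⟩ : ∃ m, i = m + 1 := ⟨i - 1, by omega⟩
    have h11 := ih m (by omega) (by omega) (tk (m + 1)) ⟨htkmono m (by omega), le_rfl⟩
    have hVle : V (tk (m + 1)) ≤ V t := hVmono (htk_mem _ hip) ht0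
      ((hle k (by omega) _ hi.2).trans ht.1.le)
    have hP : 0 ≤ ∏ j ∈ Finset.Icc 1 m,
        (1 + β j * mittagLeffler α (g * Real.Gamma α * (Ψ (tk j) - Ψ 0) ^ α)) := by
      refine Finset.prod_nonneg fun j hj => ?_
      have hjp : j ∈ Finset.Icc 1 p := Finset.Icc_subset_Icc_right (by omega) hj
      have := mul_nonneg (hβ j hjp).le (hE _ (htk_mem j hjp))
      linarith
    have hEm := hE _ (htk_mem _ hip)
    have hb' := (hβ _ hip).le
    rw [Nat.add_sub_cancel]
    calc β (m + 1) * U (tk (m + 1)) ≤ β (m + 1) * (V t * (∏ j ∈ Finset.Icc 1 m,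
        (1 + β j * mittagLeffler α (g * Real.Gamma α * (Ψ (tk j) - Ψ 0) ^ α))) *
          mittagLeffler α (g * Real.Gamma α * (Ψ (tk (m + 1)) - Ψ 0) ^ α)) := by
          refine mul_le_mul_of_nonneg_left (h11.trans ?_) hb'
          gcongr
      _ = _ := by ring
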